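/- arXiv:1711.09524 — 9 statements merged into one kernel-verified Lean document; each statement's English description precedes it below -/
import Mathlib

section
/- Let u, v be fuzzy sets on ℝ^m such that [u]_α and [v]_α are compact for every α ∈ (0,1], let θ ∈ (0,1], and let ⪰ be a partial order on ℝ^m that is preserved by limit operation, i.e., if x_n ⪰ y_n for all n, x_n → x, and y_n → y, then x ⪰ y. Then G(u ⪰ v) ≥ θ if and only if there exist x ∈ [u]_θ and y ∈ [v]_θ with x ⪰ y. -/
open Set

/-- The α-cut of a fuzzy set: for α ≠ 0 it is `{x | α ≤ u x}`;
for α = 0 it is the closure of `{x | 0 < u x}`. -/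
noncomputable def cut {X : Type*} [TopologicalSpace X] (u : X → ℝ) (α : ℝ) : Set X :=
  if α = 0 then closure {x | 0 < u x} else {x | α ≤ u x}

/-- `G r u v = sup { min (u x) (v y) : r x y }`, with `sSup ∅ = 0` in ℝ. -/
noncomputable def G {X : Type*} (r : X → X → Prop) (u v : X → ℝ) : ℝ :=
  sSup {t : ℝ | ∃ x y, r x y ∧ t = min (u x) (v y)}

theorem mem_cut_of_ne_zero {X : Type*} [TopologicalSpace X] {u : X → ℝ} {α : ℝ} (hα : α ≠ 0)
    {x : X} : x ∈ cut u α ↔ α ≤ u x := by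
  simp [cut, hα]

/-- If the positive cuts of `u` are closed, then a limit of points of the cuts at levels increasing
to `θ` lies in the cut at level `θ`. -/
theorem mem_cut_of_tendsto {X : Type*} [TopologicalSpace X] {u : X → ℝ} {θ : ℝ} (hθ : 0 < θ)
    {a : ℕ → ℝ} (ha : Monotone a) (hpos : ∀ n, 0 < a n)
    (haθ : Filter.Tendsto a Filter.atTop (nhds θ)) (hclosed : ∀ n, IsClosed (cut u (a n)))
    {x : ℕ → X} {x₀ : X} (hx : ∀ n, a n ≤ u (x n))
    (hlim : Filter.Tendsto x Filter.atTop (nhds x₀)) : x₀ ∈ cut u θ := by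
  refine (mem_cut_of_ne_zero hθ.ne').2 (le_of_tendsto' haθ fun k => ?_)
  refine (mem_cut_of_ne_zero (hpos k).ne').1 ((hclosed k).mem_of_tendsto hlim ?_)
  filter_upwards [Filter.eventually_ge_atTop k] with n hn
  exact (mem_cut_of_ne_zero (hpos k).ne').2 ((ha hn).trans (hx n))

theorem stmt2 {m : ℕ} (u v : (Fin m → ℝ) → ℝ)
    (hu : ∀ x, u x ∈ Icc (0 : ℝ) 1) (hv : ∀ x, v x ∈ Icc (0 : ℝ) 1)
    (hcu : ∀ α ∈ Ioc (0 : ℝ) 1, IsCompact (cut u α))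
    (hcv : ∀ α ∈ Ioc (0 : ℝ) 1, IsCompact (cut v α))
    (θ : ℝ) (hθ : θ ∈ Ioc (0 : ℝ) 1)
    (r : (Fin m → ℝ) → (Fin m → ℝ) → Prop)
    (hrefl : ∀ x, r x x)
    (hantisymm : ∀ x y, r x y → r y x → x = y)
    (htrans : ∀ x y z, r x y → r y z → r x z)
    (hlim : ∀ (x y : ℕ → (Fin m → ℝ)) (x₀ y₀ : Fin m → ℝ),
      (∀ n, r (x n) (y n)) →
      Filter.Tendsto x Filter.atTop (nhds x₀) →
      Filter.Tendsto y Filter.atTop (nhds y₀) → r x₀ y₀) :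
    θ ≤ G r u v ↔ ∃ x ∈ cut u θ, ∃ y ∈ cut v θ, r x y := by
  constructor
  · intro h
    obtain ⟨a, ha, ha_mem, haθ⟩ := exists_seq_strictMono_tendsto' hθ.1
    have hpos n : 0 < a n := (ha_mem n).1
    have hIoc n : a n ∈ Ioc (0 : ℝ) 1 := ⟨hpos n, (ha_mem n).2.le.trans hθ.2⟩
    have key n : ∃ p : (Fin m → ℝ) × (Fin m → ℝ), r p.1 p.2 ∧ a n ≤ u p.1 ∧ a n ≤ v p.2 := by
      obtain ⟨_, ⟨x, y, hxy, rfl⟩, hlt⟩ := exists_lt_of_lt_csSup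
        (s := {t : ℝ | ∃ x y, r x y ∧ t = min (u x) (v y)})
        ⟨_, 0, 0, hrefl 0, rfl⟩ ((ha_mem n).2.trans_le h)
      exact ⟨(x, y), hxy, le_min_iff.1 hlt.le⟩
    choose p hr hpu hpv using key
    obtain ⟨q, -, φ, hφ, hq⟩ := ((hcu _ (hIoc 0)).prod (hcv _ (hIoc 0))).tendsto_subseq
      (x := p) fun n =>
        ⟨(mem_cut_of_ne_zero (hpos 0).ne').2 ((ha.monotone n.zero_le).trans (hpu n)),
          (mem_cut_of_ne_zero (hpos 0).ne').2 ((ha.monotone n.zero_le).trans (hpv n))⟩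
    have hq₁ := (continuous_fst.tendsto q).comp hq
    have hq₂ := (continuous_snd.tendsto q).comp hq
    have haφ := (ha.comp hφ).monotone
    have haφθ := haθ.comp hφ.tendsto_atTop
    exact ⟨q.1, mem_cut_of_tendsto hθ.1 haφ (fun n => hpos _) haφθ
        (fun n => (hcu _ (hIoc _)).isClosed) (fun n => hpu (φ n)) hq₁,
      q.2, mem_cut_of_tendsto hθ.1 haφ (fun n => hpos _) haφθ
        (fun n => (hcv _ (hIoc _)).isClosed) (fun n => hpv (φ n)) hq₂,
      hlim _ _ _ _ (fun n => hr (φ n)) hq₁ hq₂⟩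
  · rintro ⟨x, hx, y, hy, hxy⟩
    rw [mem_cut_of_ne_zero hθ.1.ne'] at hx hy
    refine (le_min hx hy).trans (le_csSup ⟨1, ?_⟩ ⟨x, y, hxy, rfl⟩)
    rintro _ ⟨x, y, -, rfl⟩
    exact (min_le_left _ _).trans (hu x).2
end

section
/- Let u, v be fuzzy sets on ℝ^m such that [u]_α and [v]_α are compact for every α ∈ (0,1], and let α ∈ (0,1]. Then G(u ⪰¹ v) ≥ α if and only if there exist x ∈ [u]_α and y ∈ [v]_α with x ⪰¹ y. -/
open Set

/-- The componentwise order on ℝ^m: `x ⪰¹ y` iff `x k ≥ y k` for all `k`. -/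
def ge1 {m : ℕ} (x y : Fin m → ℝ) : Prop := ∀ k, y k ≤ x k

theorem le_of_forall_mem_Ioo_le {a b c : ℝ} (hab : a < b) (h : ∀ t ∈ Ioo a b, t ≤ c) : b ≤ c := by
  rw [← csSup_Ioo hab]
  exact csSup_le (nonempty_Ioo.2 hab) h

theorem cut_of_pos {X : Type*} [TopologicalSpace X] (u : X → ℝ) {α : ℝ} (hα : 0 < α) :
    cut u α = {x | α ≤ u x} :=
  if_neg hα.ne'

theorem isClosed_ge1 (m : ℕ) : IsClosed {p : (Fin m → ℝ) × (Fin m → ℝ) | ge1 p.1 p.2} :=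
  isClosed_le continuous_snd continuous_fst

/-- For a closed relation, a positive lower bound of `G` is attained on the corresponding cuts as
soon as all lower positive cuts are compact. -/
theorem exists_mem_cut_of_le_G {X : Type*} [TopologicalSpace X] [T2Space X] {r : X → X → Prop}
    (hr : IsClosed {p : X × X | r p.1 p.2}) {u v : X → ℝ} {α : ℝ} (hα : 0 < α)
    (hcu : ∀ β ∈ Ioo 0 α, IsCompact (cut u β)) (hcv : ∀ β ∈ Ioo 0 α, IsCompact (cut v β))
    (h : α ≤ G r u v) : ∃ x ∈ cut u α, ∃ y ∈ cut v α, r x y := by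
  let K : Ioo 0 α → Set (X × X) := fun β ↦ (cut u β ×ˢ cut v β) ∩ {p | r p.1 p.2}
  have hK : ∀ β p, p ∈ K β ↔ ((β : ℝ) ≤ u p.1 ∧ (β : ℝ) ≤ v p.2) ∧ r p.1 p.2 := fun β p ↦ by
    simp [K, cut_of_pos _ β.2.1]
  have hcompact : ∀ β, IsCompact (K β) := fun β ↦
    ((hcu β β.2).prod (hcv β β.2)).inter_right hr
  have hanti : Antitone K := fun β γ hβγ p hp ↦ by
    have hle : (β : ℝ) ≤ γ := hβγ
    obtain ⟨⟨h₁, h₂⟩, h₃⟩ := (hK γ p).1 hp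
    exact (hK β p).2 ⟨⟨hle.trans h₁, hle.trans h₂⟩, h₃⟩
  have hne : ∀ β, (K β).Nonempty := fun β ↦ by
    have hs : {t : ℝ | ∃ x y, r x y ∧ t = min (u x) (v y)}.Nonempty := by
      by_contra hs
      rw [G, not_nonempty_iff_eq_empty.1 hs, Real.sSup_empty] at h
      exact absurd h hα.not_ge
    obtain ⟨_, ⟨x, y, hxy, rfl⟩, hlt⟩ := exists_lt_of_lt_csSup hs (β.2.2.trans_le h)
    exact ⟨(x, y), (hK β _).2 ⟨le_min_iff.1 hlt.le, hxy⟩⟩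
  have : Nonempty (Ioo 0 α) := (nonempty_Ioo.2 hα).to_subtype
  obtain ⟨⟨x, y⟩, hxy⟩ := IsCompact.nonempty_iInter_of_directed_nonempty_isCompact_isClosed K
    (hanti.directed_ge) hne hcompact fun β ↦ (hcompact β).isClosed
  have hmem := fun β ↦ (hK β (x, y)).1 (mem_iInter.1 hxy β)
  rw [cut_of_pos u hα, cut_of_pos v hα]
  refine ⟨x, ?_, y, ?_, (hmem (Classical.arbitrary _)).2⟩
  · exact le_of_forall_mem_Ioo_le hα fun β hβ ↦ (hmem ⟨β, hβ⟩).1.1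
  · exact le_of_forall_mem_Ioo_le hα fun β hβ ↦ (hmem ⟨β, hβ⟩).1.2

theorem stmt4 {m : ℕ} (u v : (Fin m → ℝ) → ℝ)
    (hu : ∀ x, u x ∈ Icc (0 : ℝ) 1) (hv : ∀ x, v x ∈ Icc (0 : ℝ) 1)
    (hcu : ∀ α ∈ Ioc (0 : ℝ) 1, IsCompact (cut u α))
    (hcv : ∀ α ∈ Ioc (0 : ℝ) 1, IsCompact (cut v α))
    (α : ℝ) (hα : α ∈ Ioc (0 : ℝ) 1) :
    α ≤ G ge1 u v ↔ ∃ x ∈ cut u α, ∃ y ∈ cut v α, ge1 x y := by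
  have hsub : ∀ β ∈ Ioo 0 α, β ∈ Ioc (0 : ℝ) 1 := fun β hβ ↦ ⟨hβ.1, hβ.2.le.trans hα.2⟩
  refine ⟨exists_mem_cut_of_le_G (isClosed_ge1 m) hα.1 (fun β hβ ↦ hcu β (hsub β hβ))
    fun β hβ ↦ hcv β (hsub β hβ), ?_⟩
  rw [cut_of_pos u hα.1, cut_of_pos v hα.1]
  rintro ⟨x, hx, y, hy, hxy⟩
  refine (le_min hx hy).trans (le_csSup ⟨1, ?_⟩ ⟨x, y, hxy, rfl⟩)
  rintro _ ⟨x, y, -, rfl⟩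
  exact (min_le_left _ _).trans (hu x).2
end

section
/- Let u, v be m-cell fuzzy numbers, with [u]_α = Π_{k=1}^m [u_k⁻(α), u_k⁺(α)] and [v]_α = Π_{k=1}^m [v_k⁻(α), v_k⁺(α)], and let α ∈ (0,1]. Then G(u ⪰¹ v) ≥ α if and only if u_k⁺(α) ≥ v_k⁻(α) for every k = 1, …, m. -/
open Set

theorem update_mem_pi_Icc {ι : Type*} [DecidableEq ι] {l r a b : ι → ℝ} {k : ι} {t : ℝ}
    (ha : a ∈ Set.univ.pi fun i => Icc (l i) (r i))
    (hb : b ∈ Set.univ.pi fun i => Icc (l i) (r i)) (ht : t ∈ uIcc (a k) (b k)) :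
    Function.update a k t ∈ Set.univ.pi fun i => Icc (l i) (r i) := by
  intro i _
  rcases eq_or_ne i k with rfl | hik
  · rw [Function.update_self]
    exact uIcc_subset_Icc (ha i trivial) (hb i trivial) ht
  · rw [Function.update_of_ne hik]
    exact ha i trivial

theorem bddAbove_min_values {X : Type*} (r : X → X → Prop) {u : X → ℝ} (v : X → ℝ)
    (hu : ∀ x, u x ≤ 1) : BddAbove {t : ℝ | ∃ x y, r x y ∧ t = min (u x) (v y)} := by
  refine ⟨1, ?_⟩
  rintro _ ⟨x, y, -, rfl⟩
  exact (min_le_left _ _).trans (hu x)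

theorem exists_lt_of_lt_G {X : Type*} {r : X → X → Prop} {u v : X → ℝ} {x₀ : X}
    (hr : r x₀ x₀) {β : ℝ} (hβ : β < G r u v) : ∃ x y, r x y ∧ β < u x ∧ β < v y := by
  obtain ⟨_, ⟨x, y, hxy, rfl⟩, hlt⟩ := exists_lt_of_lt_csSup (by exact ⟨_, x₀, x₀, hr, rfl⟩) hβ
  exact ⟨x, y, hxy, lt_min_iff.mp hlt⟩

theorem stmt5 {m : ℕ} (u v : (Fin m → ℝ) → ℝ)
    (hu : ∀ x, u x ∈ Icc (0 : ℝ) 1) (hv : ∀ x, v x ∈ Icc (0 : ℝ) 1)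
    (um up vm vp : ℝ → Fin m → ℝ)
    (huleb : ∀ β ∈ Icc (0 : ℝ) 1, ∀ k, um β k ≤ up β k)
    (hvleb : ∀ β ∈ Icc (0 : ℝ) 1, ∀ k, vm β k ≤ vp β k)
    (hucut : ∀ β ∈ Icc (0 : ℝ) 1,
      cut u β = Set.univ.pi (fun k => Icc (um β k) (up β k)))
    (hvcut : ∀ β ∈ Icc (0 : ℝ) 1,
      cut v β = Set.univ.pi (fun k => Icc (vm β k) (vp β k)))
    (α : ℝ) (hα : α ∈ Ioc (0 : ℝ) 1) :
    α ≤ G ge1 u v ↔ ∀ k, vm α k ≤ up α k := by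
  have mem_u : ∀ β ∈ Ioc (0 : ℝ) 1, ∀ x,
      x ∈ Set.univ.pi (fun k => Icc (um β k) (up β k)) ↔ β ≤ u x := by
    intro β hβ x
    rw [← hucut β (Ioc_subset_Icc_self hβ), cut, if_neg hβ.1.ne', mem_ofPred_eq]
  have mem_v : ∀ β ∈ Ioc (0 : ℝ) 1, ∀ x,
      x ∈ Set.univ.pi (fun k => Icc (vm β k) (vp β k)) ↔ β ≤ v x := by
    intro β hβ x
    rw [← hvcut β (Ioc_subset_Icc_self hβ), cut, if_neg hβ.1.ne', mem_ofPred_eq]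
  have hup : α ≤ u (up α) := (mem_u α hα _).mp fun k _ =>
    ⟨huleb α (Ioc_subset_Icc_self hα) k, le_rfl⟩
  have hvm : α ≤ v (vm α) := (mem_v α hα _).mp fun k _ =>
    ⟨le_rfl, hvleb α (Ioc_subset_Icc_self hα) k⟩
  constructor
  · intro hG k
    by_contra! hk
    obtain ⟨t, hct, htd⟩ := exists_between hk
    have hp : u (Function.update (up α) k t) < α := by
      by_contra! h
      have := ((mem_u α hα _).mpr h k trivial).2
      rw [Function.update_self] at this
      exact this.not_gt hct
    have hq : v (Function.update (vm α) k t) < α := by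
      by_contra! h
      have := ((mem_v α hα _).mpr h k trivial).1
      rw [Function.update_self] at this
      exact this.not_gt htd
    obtain ⟨β, hβ, hβα⟩ := exists_between (max_lt hp hq)
    obtain ⟨hpβ, hqβ⟩ := max_lt_iff.mp hβ
    have hβI : β ∈ Ioc (0 : ℝ) 1 := ⟨(hu _).1.trans_lt hpβ, hβα.le.trans hα.2⟩
    obtain ⟨x, y, hxy, hx, hy⟩ :=
      exists_lt_of_lt_G (x₀ := (0 : Fin m → ℝ)) (fun _ => le_rfl) (hβα.trans_le hG)
    rcases le_total t (x k) with htx | hxt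
    · exact hpβ.not_ge <| (mem_u β hβI _).mp <|
        update_mem_pi_Icc ((mem_u β hβI _).mpr (hβα.le.trans hup))
          ((mem_u β hβI _).mpr hx.le) (mem_uIcc_of_le hct.le htx)
    · exact hqβ.not_ge <| (mem_v β hβI _).mp <|
        update_mem_pi_Icc ((mem_v β hβI _).mpr (hβα.le.trans hvm))
          ((mem_v β hβI _).mpr hy.le) (mem_uIcc_of_ge ((hxy k).trans hxt) htd.le)
  · intro h
    exact (le_min hup hvm).trans <|
      le_csSup (bddAbove_min_values ge1 v fun x => (hu x).2) ⟨up α, vm α, h, rfl⟩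
end

section
/- Let u, v be fuzzy sets on ℝ^m, let α > 0, and suppose v is positive, i.e., v(y) > 0 implies y_i > 0 for all i = 1, …, m. If G(u ⪰¹ v) ≥ α, then G(u/v ⪰¹ 𝟙) ≥ α, where 𝟙 is the fuzzy set that takes value 1 at the point (1, …, 1) ∈ ℝ^m and value 0 elsewhere. -/
open Set

/-- The quotient `u/v` of fuzzy sets on ℝ^m, the Zadeh extension of
componentwise division. -/
noncomputable def fdiv {m : ℕ} (u v : (Fin m → ℝ) → ℝ) : (Fin m → ℝ) → ℝ :=
  fun z => sSup {t : ℝ | ∃ x y : Fin m → ℝ,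
    (∀ i, x i / y i = z i) ∧ t = min (u x) (v y)}

theorem le_G {X : Type*} {r : X → X → Prop} {u v : X → ℝ} (hv : ∀ y, v y ≤ 1)
    {x y : X} (hxy : r x y) : min (u x) (v y) ≤ G r u v := by
  refine le_csSup ⟨1, ?_⟩ ⟨x, y, hxy, rfl⟩
  rintro _ ⟨x, y, -, rfl⟩
  exact (min_le_right _ _).trans (hv y)

theorem G_nonneg {X : Type*} {r : X → X → Prop} {u v : X → ℝ} (hu : ∀ x, 0 ≤ u x)
    (hv : ∀ y, 0 ≤ v y) : 0 ≤ G r u v := by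
  refine Real.sSup_nonneg ?_
  rintro _ ⟨x, y, -, rfl⟩
  exact le_min (hu x) (hv y)

theorem le_fdiv {m : ℕ} {u v : (Fin m → ℝ) → ℝ} (hv : ∀ y, v y ≤ 1) (x y : Fin m → ℝ) :
    min (u x) (v y) ≤ fdiv u v (x / y) := by
  refine le_csSup ⟨1, ?_⟩ ⟨x, y, fun _ => rfl, rfl⟩
  rintro _ ⟨x, y, -, rfl⟩
  exact (min_le_right _ _).trans (hv y)

theorem fdiv_nonneg {m : ℕ} {u v : (Fin m → ℝ) → ℝ} (hu : ∀ x, 0 ≤ u x)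
    (hv : ∀ y, 0 ≤ v y) (z : Fin m → ℝ) : 0 ≤ fdiv u v z := by
  refine Real.sSup_nonneg ?_
  rintro _ ⟨x, y, -, rfl⟩
  exact le_min (hu x) (hv y)

theorem stmt7 {m : ℕ} (u v : (Fin m → ℝ) → ℝ)
    (hu : ∀ x, u x ∈ Icc (0 : ℝ) 1) (hv : ∀ x, v x ∈ Icc (0 : ℝ) 1)
    (α : ℝ) (hα : 0 < α)
    (hpos : ∀ y : Fin m → ℝ, 0 < v y → ∀ i, 0 < y i)
    (h : α ≤ G ge1 u v) :
    α ≤ G ge1 (fdiv u v) (fun x => if x = (fun _ => (1 : ℝ)) then 1 else 0) := by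
  have hG : 0 ≤ G ge1 (fdiv u v) (fun x => if x = (fun _ => (1 : ℝ)) then 1 else 0) :=
    G_nonneg (fdiv_nonneg (fun x => (hu x).1) (fun y => (hv y).1)) (fun z => by positivity)
  refine h.trans (Real.sSup_le ?_ hG)
  rintro _ ⟨x, y, hxy, rfl⟩
  rcases le_or_gt (v y) 0 with hy | hy
  · exact ((min_le_right _ _).trans hy).trans hG
  · have hge : ge1 (x / y) (fun _ => (1 : ℝ)) := fun i =>
      (one_le_div (hpos y hy i)).2 (hxy i)
    refine le_trans ?_ (le_G ?_ hge)
    · rw [if_pos rfl]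
      exact le_min (le_fdiv (fun y => (hv y).2) x y) ((min_le_right _ _).trans (hv y).2)
    · intro z
      split_ifs <;> norm_num
end

section
/- Let m ≥ 2 and θ ∈ (0,1). There exist m-cell fuzzy numbers u, v such that G(u ⪰¹ v) ≥ θ, but neither (G(u ⪰¹ v) = 1 and G(v ⪰¹ u) < θ) nor (G(u ⪰¹ v) ≥ θ and G(v ⪰¹ u) ≥ θ) holds. -/
open Set

/-- An m-cell fuzzy number: a fuzzy set on ℝ^m all of whose α-cuts, α ∈ [0,1],
are nonempty compact cells `Π_k [a k, b k]`. -/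
def IsCellFuzzyNumber {m : ℕ} (u : (Fin m → ℝ) → ℝ) : Prop :=
  (∀ x, u x ∈ Icc (0 : ℝ) 1) ∧
  ∀ α ∈ Icc (0 : ℝ) 1, ∃ a b : Fin m → ℝ, (∀ k, a k ≤ b k) ∧
    cut u α = Set.univ.pi (fun k => Icc (a k) (b k))

/-- The fuzzy set with value `1` at `p`, value `θ` on the rest of the cell `Icc p q`,
and value `0` elsewhere. -/
noncomputable def stepCell {m : ℕ} (p q : Fin m → ℝ) (θ : ℝ) (x : Fin m → ℝ) : ℝ :=
  open Classical in if x = p then 1 else if x ∈ Icc p q then θ else 0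

theorem stepCell_mem_Icc {m : ℕ} (p q : Fin m → ℝ) {θ : ℝ} (hθ : θ ∈ Ioo (0 : ℝ) 1)
    (x : Fin m → ℝ) : stepCell p q θ x ∈ Icc (0 : ℝ) 1 := by
  obtain ⟨h0, h1⟩ := hθ
  unfold stepCell
  split_ifs <;> constructor <;> linarith

theorem stepCell_self {m : ℕ} (p q : Fin m → ℝ) (θ : ℝ) : stepCell p q θ p = 1 :=
  if_pos rfl

theorem stepCell_le_of_ne {m : ℕ} {p q x : Fin m → ℝ} {θ : ℝ} (hθ : θ ∈ Ioo (0 : ℝ) 1)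
    (hx : x ≠ p) : stepCell p q θ x ≤ θ := by
  rw [stepCell, if_neg hx]
  split_ifs
  exacts [le_rfl, hθ.1.le]

theorem le_stepCell {m : ℕ} {p q x : Fin m → ℝ} {θ : ℝ} (hθ : θ ∈ Ioo (0 : ℝ) 1)
    (hx : x ∈ Icc p q) : θ ≤ stepCell p q θ x := by
  obtain ⟨h0, h1⟩ := hθ
  unfold stepCell
  split_ifs <;> linarith

theorem stepCell_eq_zero {m : ℕ} {p q x : Fin m → ℝ} {θ : ℝ} (hpq : p ≤ q)
    (hx : x ∉ Icc p q) : stepCell p q θ x = 0 := by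
  have hne : x ≠ p := by
    rintro rfl
    exact hx (left_mem_Icc.2 hpq)
  simp only [stepCell, if_neg hne, if_neg hx]

theorem isCellFuzzyNumber_stepCell {m : ℕ} {p q : Fin m → ℝ} (hpq : p ≤ q) {θ : ℝ}
    (hθ : θ ∈ Ioo (0 : ℝ) 1) : IsCellFuzzyNumber (stepCell p q θ) := by
  refine ⟨stepCell_mem_Icc p q hθ, fun α hα => ?_⟩
  rcases le_or_gt α θ with h | h
  · refine ⟨p, q, hpq, ?_⟩
    rw [pi_univ_Icc]
    unfold cut
    split_ifs with h0
    · have hpos : {x | 0 < stepCell p q θ x} = Icc p q := by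
        ext x
        refine ⟨fun hx => ?_, fun hx => hθ.1.trans_le (le_stepCell hθ hx)⟩
        by_contra hn
        exact (ne_of_gt hx) (stepCell_eq_zero hpq hn)
      rw [hpos, isClosed_Icc.closure_eq]
    · ext x
      refine ⟨fun hx => ?_, fun hx => h.trans (le_stepCell hθ hx)⟩
      by_contra hn
      have hx' : α ≤ stepCell p q θ x := hx
      rw [stepCell_eq_zero hpq hn] at hx'
      exact h0 (le_antisymm hx' hα.1)
  · refine ⟨p, p, fun _ => le_rfl, ?_⟩
    rw [pi_univ_Icc, Icc_self, cut, if_neg (hθ.1.trans h).ne']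
    ext x
    constructor
    · intro hx
      by_contra hn
      exact (h.trans_le hx).not_ge (stepCell_le_of_ne hθ hn)
    · rintro rfl
      exact hα.2.trans_eq (stepCell_self _ _ _).symm

theorem min_le_G {X : Type*} {r : X → X → Prop} {u v : X → ℝ} (hu : ∀ x, u x ≤ 1) {x y : X}
    (h : r x y) : min (u x) (v y) ≤ G r u v := by
  refine le_csSup ⟨1, ?_⟩ ⟨x, y, h, rfl⟩
  rintro _ ⟨a, b, -, rfl⟩
  exact (min_le_left _ _).trans (hu a)

theorem G_le {X : Type*} {r : X → X → Prop} {u v : X → ℝ} {c : ℝ} (hc : 0 ≤ c)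
    (h : ∀ x y, r x y → min (u x) (v y) ≤ c) : G r u v ≤ c := by
  refine Real.sSup_le ?_ hc
  rintro _ ⟨x, y, hxy, rfl⟩
  exact h x y hxy

theorem stmt11 {m : ℕ} (hm : 2 ≤ m) (θ : ℝ) (hθ : θ ∈ Ioo (0 : ℝ) 1) :
    ∃ u v : (Fin m → ℝ) → ℝ, IsCellFuzzyNumber u ∧ IsCellFuzzyNumber v ∧
      θ ≤ G ge1 u v ∧
      ¬((G ge1 u v = 1 ∧ G ge1 v u < θ) ∨ (θ ≤ G ge1 u v ∧ θ ≤ G ge1 v u)) := by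
  let i : Fin m := ⟨0, by lia⟩
  let j : Fin m := ⟨1, by lia⟩
  have hji : j ≠ i := by simp [i, j]
  let p : Fin m → ℝ := Function.update 1 i (-1)
  have hpi : p i = -1 := Function.update_self ..
  have hpj : p j = 1 := Function.update_of_ne hji ..
  have hpq : p ≤ 1 := update_le_self_iff.2 (by norm_num)
  have hv : ∀ y, y ≠ 0 → stepCell (0 : Fin m → ℝ) 0 θ y = 0 := fun y hy =>
    stepCell_eq_zero le_rfl (by simpa using hy)
  have hle : G ge1 (stepCell p 1 θ) (stepCell 0 0 θ) ≤ θ := by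
    refine G_le hθ.1.le fun x y hxy => ?_
    by_cases hy : y = 0
    · refine (min_le_left _ _).trans (stepCell_le_of_ne hθ ?_)
      rintro rfl
      have := hxy i
      rw [hpi, hy, Pi.zero_apply] at this
      linarith
    · exact (min_le_right _ _).trans ((hv y hy).trans_le hθ.1.le)
  have hzero : G ge1 (stepCell 0 0 θ) (stepCell p 1 θ) ≤ 0 := by
    refine G_le le_rfl fun x y hxy => ?_
    by_cases hx : x = 0
    · refine (min_le_right _ _).trans (stepCell_eq_zero hpq fun hy => ?_).le
      have h1 := hxy j
      have h2 := hy.1 j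
      rw [hx, Pi.zero_apply] at h1
      rw [hpj] at h2
      linarith
    · exact (min_le_left _ _).trans (hv x hx).le
  refine ⟨stepCell p 1 θ, stepCell 0 0 θ, isCellFuzzyNumber_stepCell hpq hθ,
    isCellFuzzyNumber_stepCell le_rfl hθ, ?_, ?_⟩
  · refine le_trans (le_min (le_stepCell hθ (right_mem_Icc.2 hpq)) ?_)
      (min_le_G (fun x => (stepCell_mem_Icc p 1 hθ x).2) (x := 1) (y := 0) ?_)
    · exact le_stepCell hθ (left_mem_Icc.2 le_rfl)
    · exact fun _ => zero_le_one
  · rintro (⟨h, -⟩ | ⟨-, h⟩)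
    · linarith [hθ.2]
    · linarith [hθ.1]
end

section
/- Let u, v be m-cell fuzzy numbers, with [u]_α = Π_{k=1}^m [u_k⁻(α), u_k⁺(α)] and [v]_α = Π_{k=1}^m [v_k⁻(α), v_k⁺(α)], and let α ∈ (0,1]. Then (G(u ⪰¹ v) ≥ α and not G(v ⪰¹ u) ≥ α) holds if and only if u_k⁺(α) ≥ v_k⁻(α) for every k = 1, …, m and u_j⁻(α) > v_j⁺(α) for some j with 1 ≤ j ≤ m. -/
open Set

theorem mem_Icc_iff_le_of_cut_eq {m : ℕ} {u : (Fin m → ℝ) → ℝ} {um up : ℝ → Fin m → ℝ}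
    (hucut : ∀ β ∈ Icc (0 : ℝ) 1,
      cut u β = Set.univ.pi (fun k => Icc (um β k) (up β k)))
    {β : ℝ} (hβ : β ∈ Ioc (0 : ℝ) 1) (x : Fin m → ℝ) :
    (∀ k, x k ∈ Icc (um β k) (up β k)) ↔ β ≤ u x := by
  have h := Set.ext_iff.1 (hucut β ⟨hβ.1.le, hβ.2⟩) x
  simp only [cut, if_neg hβ.1.ne', mem_ofPred_eq, Set.mem_univ_pi] at h
  exact h.symm

/-- A value outside the `k`-th side of the `α`-cut is outside the `k`-th side of the `β`-cut
for all `β` slightly below `α`. -/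
theorem exists_lt_forall_notMem_Icc {m : ℕ} {u : (Fin m → ℝ) → ℝ} {um up : ℝ → Fin m → ℝ}
    (hu : ∀ x, 0 ≤ u x)
    (huleb : ∀ β ∈ Icc (0 : ℝ) 1, ∀ k, um β k ≤ up β k)
    (hucut : ∀ β ∈ Icc (0 : ℝ) 1,
      cut u β = Set.univ.pi (fun k => Icc (um β k) (up β k)))
    {α : ℝ} (hα : α ∈ Ioc (0 : ℝ) 1) {k : Fin m} {c : ℝ}
    (hc : c ∉ Icc (um α k) (up α k)) :
    ∃ γ, 0 ≤ γ ∧ γ < α ∧ ∀ β, γ < β → β ≤ α →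
      c ∉ Icc (um β k) (up β k) ∧ um β k ≤ um α k ∧ up α k ≤ up β k := by
  have hle := huleb α ⟨hα.1.le, hα.2⟩
  have hx : ¬ α ≤ u (Function.update (um α) k c) := by
    rw [← mem_Icc_iff_le_of_cut_eq hucut hα]
    intro h
    exact hc (by simpa using h k)
  refine ⟨_, hu (Function.update (um α) k c), not_le.1 hx, fun β hγβ hβα => ?_⟩
  have hβ : β ∈ Ioc (0 : ℝ) 1 := ⟨(hu _).trans_lt hγβ, hβα.trans hα.2⟩
  have hmem := mem_Icc_iff_le_of_cut_eq hucut hβ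
  have hm := (hmem (um α)).2 (hβα.trans
    ((mem_Icc_iff_le_of_cut_eq hucut hα _).1 fun j => ⟨le_rfl, hle j⟩))
  have hp := (hmem (up α)).2 (hβα.trans
    ((mem_Icc_iff_le_of_cut_eq hucut hα _).1 fun j => ⟨hle j, le_rfl⟩))
  refine ⟨fun h => hγβ.not_ge ((hmem _).1 fun j => ?_), (hm k).1, (hp k).2⟩
  by_cases hj : j = k
  · subst hj
    simpa using h
  · simpa [Function.update_of_ne hj] using hm j

theorem le_G_ge1_iff {m : ℕ} {u v : (Fin m → ℝ) → ℝ}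
    (hu : ∀ x, u x ∈ Icc (0 : ℝ) 1) (hv : ∀ x, v x ∈ Icc (0 : ℝ) 1)
    {um up vm vp : ℝ → Fin m → ℝ}
    (huleb : ∀ β ∈ Icc (0 : ℝ) 1, ∀ k, um β k ≤ up β k)
    (hvleb : ∀ β ∈ Icc (0 : ℝ) 1, ∀ k, vm β k ≤ vp β k)
    (hucut : ∀ β ∈ Icc (0 : ℝ) 1,
      cut u β = Set.univ.pi (fun k => Icc (um β k) (up β k)))
    (hvcut : ∀ β ∈ Icc (0 : ℝ) 1,
      cut v β = Set.univ.pi (fun k => Icc (vm β k) (vp β k)))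
    {α : ℝ} (hα : α ∈ Ioc (0 : ℝ) 1) :
    α ≤ G ge1 u v ↔ ∀ k, vm α k ≤ up α k := by
  have hule := huleb α ⟨hα.1.le, hα.2⟩
  have hvle := hvleb α ⟨hα.1.le, hα.2⟩
  constructor
  · intro hG k
    by_contra! hlt
    obtain ⟨c, hc₁, hc₂⟩ := exists_between hlt
    obtain ⟨γ, hγ₀, hγα, hγ⟩ := exists_lt_forall_notMem_Icc (fun x => (hu x).1) huleb hucut hα
      (fun h : c ∈ Icc (um α k) (up α k) => hc₁.not_ge h.2)
    obtain ⟨δ, hδ₀, hδα, hδ⟩ := exists_lt_forall_notMem_Icc (fun x => (hv x).1) hvleb hvcut hα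
      (fun h : c ∈ Icc (vm α k) (vp α k) => hc₂.not_ge h.1)
    obtain ⟨β, hβ, hβα⟩ := exists_between (max_lt hγα hδα)
    obtain ⟨hγβ, hδβ⟩ := max_lt_iff.1 hβ
    have hβ' : β ∈ Ioc (0 : ℝ) 1 := ⟨hγ₀.trans_lt hγβ, hβα.le.trans hα.2⟩
    obtain ⟨t, ⟨x, y, hxy, rfl⟩, ht⟩ :=
      exists_lt_of_lt_csSup (s := {t : ℝ | ∃ x y, ge1 x y ∧ t = min (u x) (v y)})
        ⟨_, 0, 0, fun _ => le_rfl, rfl⟩ (hβα.trans_le hG)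
    obtain ⟨hux, hvy⟩ := lt_min_iff.1 ht
    have hx := (mem_Icc_iff_le_of_cut_eq hucut hβ' x).2 hux.le k
    have hy := (mem_Icc_iff_le_of_cut_eq hvcut hβ' y).2 hvy.le k
    obtain ⟨h₁, h₂, -⟩ := hγ β hγβ hβα.le
    obtain ⟨h₃, -, h₄⟩ := hδ β hδβ hβα.le
    have hup : up β k < c := by
      by_contra! h
      exact h₁ ⟨by linarith [hule k], h⟩
    have hvm : c < vm β k := by
      by_contra! h
      exact h₃ ⟨h, by linarith [hvle k]⟩
    linarith [hxy k, hx.2, hy.1]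
  · intro h
    have hux := (mem_Icc_iff_le_of_cut_eq hucut hα (up α)).1 fun k => ⟨hule k, le_rfl⟩
    have hvy := (mem_Icc_iff_le_of_cut_eq hvcut hα (vm α)).1 fun k => ⟨le_rfl, hvle k⟩
    refine (le_min hux hvy).trans (le_csSup ⟨1, ?_⟩ ⟨up α, vm α, h, rfl⟩)
    rintro t ⟨x, y, -, rfl⟩
    exact (min_le_left _ _).trans (hu x).2

theorem stmt12 {m : ℕ} (u v : (Fin m → ℝ) → ℝ)
    (hu : ∀ x, u x ∈ Icc (0 : ℝ) 1) (hv : ∀ x, v x ∈ Icc (0 : ℝ) 1)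
    (um up vm vp : ℝ → Fin m → ℝ)
    (huleb : ∀ β ∈ Icc (0 : ℝ) 1, ∀ k, um β k ≤ up β k)
    (hvleb : ∀ β ∈ Icc (0 : ℝ) 1, ∀ k, vm β k ≤ vp β k)
    (hucut : ∀ β ∈ Icc (0 : ℝ) 1,
      cut u β = Set.univ.pi (fun k => Icc (um β k) (up β k)))
    (hvcut : ∀ β ∈ Icc (0 : ℝ) 1,
      cut v β = Set.univ.pi (fun k => Icc (vm β k) (vp β k)))
    (α : ℝ) (hα : α ∈ Ioc (0 : ℝ) 1) :
    (α ≤ G ge1 u v ∧ ¬ α ≤ G ge1 v u) ↔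
      ((∀ k, vm α k ≤ up α k) ∧ ∃ j, vp α j < um α j) := by
  rw [le_G_ge1_iff hu hv huleb hvleb hucut hvcut hα,
    le_G_ge1_iff hv hu hvleb huleb hvcut hucut hα]
  simp only [not_forall, not_le]
end

section
/- Let m ≥ 2 and α ∈ (0,1]. There exist m-cell fuzzy numbers u, v and sequences of m-cell fuzzy numbers (u_n), (v_n) such that (u_n) level converges to u and (v_n) level converges to v (i.e., for every θ ∈ [0,1] the Hausdorff distance between [u_n]_θ and [u]_θ, and between [v_n]_θ and [v]_θ, tends to 0 as n → ∞), G(u ⪰¹ v) ≥ α and not G(v ⪰¹ u) ≥ α, but G(u_n ⪰¹ v_n) ≥ α fails for every n. -/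
open Set

/-- Level convergence of a sequence of fuzzy sets: the Hausdorff distance between
the θ-cuts tends to 0 for every θ ∈ [0,1]. -/
def LevelConv {m : ℕ} (w : ℕ → (Fin m → ℝ) → ℝ) (u : (Fin m → ℝ) → ℝ) : Prop :=
  ∀ θ ∈ Icc (0 : ℝ) 1,
    Filter.Tendsto (fun n => Metric.hausdorffDist (cut (w n) θ) (cut u θ))
      Filter.atTop (nhds 0)

/-- The characteristic function of a point, regarded as a fuzzy set. -/
noncomputable def crispPoint {m : ℕ} (p : Fin m → ℝ) : (Fin m → ℝ) → ℝ :=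
  indicator {p} 1

theorem crispPoint_self {m : ℕ} (p : Fin m → ℝ) : crispPoint p p = 1 := by
  simp [crispPoint]

theorem crispPoint_of_ne {m : ℕ} {p x : Fin m → ℝ} (h : x ≠ p) : crispPoint p x = 0 := by
  simp [crispPoint, h]

theorem crispPoint_mem_Icc {m : ℕ} (p x : Fin m → ℝ) : crispPoint p x ∈ Icc (0 : ℝ) 1 := by
  by_cases h : x = p
  · simp [h, crispPoint_self]
  · simp [crispPoint_of_ne h]

theorem setOf_le_crispPoint {m : ℕ} (p : Fin m → ℝ) {θ : ℝ} (h₀ : 0 < θ) (h₁ : θ ≤ 1) :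
    {x | θ ≤ crispPoint p x} = {p} := by
  ext x
  by_cases h : x = p
  · simp [h, crispPoint_self, h₁]
  · simp [crispPoint_of_ne h, h, h₀]

theorem support_crispPoint {m : ℕ} (p : Fin m → ℝ) : {x | 0 < crispPoint p x} = {p} := by
  ext x
  by_cases h : x = p
  · simp [h, crispPoint_self]
  · simp [crispPoint_of_ne h, h]

theorem cut_crispPoint {m : ℕ} (p : Fin m → ℝ) {θ : ℝ} (hθ : θ ∈ Icc (0 : ℝ) 1) :
    cut (crispPoint p) θ = {p} := by
  unfold cut
  split_ifs with h
  · rw [support_crispPoint, closure_singleton]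
  · exact setOf_le_crispPoint p (lt_of_le_of_ne hθ.1 (Ne.symm h)) hθ.2

theorem isCellFuzzyNumber_crispPoint {m : ℕ} (p : Fin m → ℝ) :
    IsCellFuzzyNumber (crispPoint p) := by
  refine ⟨crispPoint_mem_Icc p, fun θ hθ => ⟨p, p, fun _ => le_rfl, ?_⟩⟩
  simp [cut_crispPoint p hθ, univ_pi_singleton]

theorem levelConv_crispPoint {m : ℕ} {p : ℕ → Fin m → ℝ} {q : Fin m → ℝ}
    (h : Filter.Tendsto p Filter.atTop (nhds q)) :
    LevelConv (fun n => crispPoint (p n)) (crispPoint q) := by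
  intro θ hθ
  simpa only [cut_crispPoint _ hθ, Metric.hausdorffDist_singleton] using
    tendsto_iff_dist_tendsto_zero.1 h

theorem one_le_G_crispPoint {m : ℕ} {r : (Fin m → ℝ) → (Fin m → ℝ) → Prop}
    {p q : Fin m → ℝ} (h : r p q) : 1 ≤ G r (crispPoint p) (crispPoint q) := by
  refine le_csSup ⟨1, ?_⟩ ⟨p, q, h, by simp [crispPoint_self]⟩
  rintro _ ⟨x, y, -, rfl⟩
  exact (min_le_left _ _).trans (crispPoint_mem_Icc p x).2

theorem G_crispPoint_nonpos {m : ℕ} {r : (Fin m → ℝ) → (Fin m → ℝ) → Prop}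
    {p q : Fin m → ℝ} (h : ¬ r p q) : G r (crispPoint p) (crispPoint q) ≤ 0 := by
  refine Real.sSup_le ?_ le_rfl
  rintro _ ⟨x, y, hxy, rfl⟩
  by_cases hx : x = p
  · have hy : y ≠ q := by
      rintro rfl
      exact h (hx ▸ hxy)
    exact (min_le_right _ _).trans_eq (crispPoint_of_ne hy)
  · exact (min_le_left _ _).trans_eq (crispPoint_of_ne hx)

theorem stmt13 {m : ℕ} (hm : 2 ≤ m) (α : ℝ) (hα : α ∈ Ioc (0 : ℝ) 1) :
    ∃ (u v : (Fin m → ℝ) → ℝ) (un vn : ℕ → (Fin m → ℝ) → ℝ),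
      IsCellFuzzyNumber u ∧ IsCellFuzzyNumber v ∧
      (∀ n, IsCellFuzzyNumber (un n)) ∧ (∀ n, IsCellFuzzyNumber (vn n)) ∧
      LevelConv un u ∧ LevelConv vn v ∧
      α ≤ G ge1 u v ∧ ¬ α ≤ G ge1 v u ∧
      ∀ n, ¬ α ≤ G ge1 (un n) (vn n) := by
  let i : Fin m := ⟨0, by omega⟩
  let j : Fin m := ⟨1, by omega⟩
  have hji : j ≠ i := by simp [i, j]
  let p : ℝ → Fin m → ℝ := fun ε => Function.update (fun _ => -ε) i 1
  have hpi (ε : ℝ) : p ε i = 1 := by simp [p]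
  have hpj (ε : ℝ) : p ε j = -ε := by simp [p, hji]
  have hp : Continuous p := by fun_prop
  refine ⟨crispPoint (p 0), crispPoint 0, fun n => crispPoint (p (1 / ((n : ℝ) + 1))),
    fun _ => crispPoint 0, isCellFuzzyNumber_crispPoint _, isCellFuzzyNumber_crispPoint _,
    fun _ => isCellFuzzyNumber_crispPoint _, fun _ => isCellFuzzyNumber_crispPoint _,
    levelConv_crispPoint ((hp.tendsto 0).comp tendsto_one_div_add_atTop_nhds_zero_nat),
    levelConv_crispPoint tendsto_const_nhds, hα.2.trans (one_le_G_crispPoint ?_),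
    not_le.2 ((G_crispPoint_nonpos ?_).trans_lt hα.1),
    fun n => not_le.2 ((G_crispPoint_nonpos ?_).trans_lt hα.1)⟩
  · intro k
    by_cases hk : k = i
    · simp [hk, hpi]
    · simp [p, hk]
  · intro h
    have := h i
    rw [hpi, Pi.zero_apply] at this
    linarith
  · intro h
    have := h j
    rw [hpj, Pi.zero_apply] at this
    have : (0 : ℝ) < 1 / ((n : ℝ) + 1) := by positivity
    linarith
end

section
/- Let u be a fuzzy set on ℝ^m such that [u]_α is compact for every α ∈ (0,1], let f : ℝ^m → ℝ^n be continuous, and let α ∈ (0,1]. Then the α-cut of the Zadeh extension f(u) equals the image of the α-cut of u: [f(u)]_α = f([u]_α). -/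
open Set

/-- The Zadeh extension of `f` applied to the fuzzy set `u`:
`zadeh f u y = sup { u x : f x = y }`, with `sSup ∅ = 0` in ℝ. -/
noncomputable def zadeh {X Y : Type*} (f : X → Y) (u : X → ℝ) : Y → ℝ :=
  fun y => sSup {t : ℝ | ∃ x, f x = y ∧ t = u x}

/-- A fuzzy set whose positive cuts are all closed is upper semicontinuous. -/
theorem upperSemicontinuous_of_isClosed_cut {X : Type*} [TopologicalSpace X] {u : X → ℝ}
    (hu : ∀ x, u x ∈ Icc (0 : ℝ) 1) (hcl : ∀ β ∈ Ioc (0 : ℝ) 1, IsClosed (cut u β)) :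
    UpperSemicontinuous u := by
  intro x c hc
  rcases le_or_gt c 1 with h1 | h1
  · have h0 : 0 < c := (hu x).1.trans_lt hc
    have hcut := hcl c ⟨h0, h1⟩
    rw [cut, if_neg h0.ne'] at hcut
    filter_upwards [hcut.isOpen_compl.mem_nhds (x := x) (not_le.mpr hc)] with z hz
    exact not_le.mp hz
  · exact Filter.Eventually.of_forall fun z => (hu z).2.trans_lt h1

theorem stmt14 {m n : ℕ} (u : (Fin m → ℝ) → ℝ)
    (hu : ∀ x, u x ∈ Icc (0 : ℝ) 1)
    (hcu : ∀ β ∈ Ioc (0 : ℝ) 1, IsCompact (cut u β))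
    (f : (Fin m → ℝ) → (Fin n → ℝ)) (hf : Continuous f)
    (α : ℝ) (hα : α ∈ Ioc (0 : ℝ) 1) :
    cut (zadeh f u) α = f '' (cut u α) := by
  have h0 : 0 < α := hα.1
  have h2 : α / 2 ∈ Ioc (0 : ℝ) 1 := ⟨by linarith, by linarith [hα.2]⟩
  have husc : UpperSemicontinuous u :=
    upperSemicontinuous_of_isClosed_cut hu fun β hβ => (hcu β hβ).isClosed
  ext y
  simp only [cut, zadeh, if_neg h0.ne', mem_ofPred_eq, mem_image]
  constructor
  · intro hy
    have hne : {t : ℝ | ∃ x, f x = y ∧ t = u x}.Nonempty := by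
      by_contra h
      rw [not_nonempty_iff_eq_empty.mp h, Real.sSup_empty] at hy
      linarith
    obtain ⟨_, ⟨x₀, hx₀, rfl⟩, hlt⟩ :=
      exists_lt_of_lt_csSup hne ((half_lt_self h0).trans_le hy)
    have hK : IsCompact ({x | α / 2 ≤ u x} ∩ f ⁻¹' {y}) := by
      have := hcu _ h2
      rw [cut, if_neg h2.1.ne'] at this
      exact this.inter_right (isClosed_singleton.preimage hf)
    have hKne : ({x | α / 2 ≤ u x} ∩ f ⁻¹' {y}).Nonempty := ⟨x₀, hlt.le, hx₀⟩
    obtain ⟨x, ⟨hx, hxy⟩, hmax⟩ :=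
      UpperSemicontinuousOn.exists_isMaxOn hKne hK (husc.upperSemicontinuousOn _)
    refine ⟨x, hy.trans (csSup_le hne ?_), hxy⟩
    rintro _ ⟨z, hz, rfl⟩
    rcases le_or_gt (α / 2) (u z) with h | h
    · exact hmax ⟨h, hz⟩
    · exact h.le.trans hx
  · rintro ⟨x, hx, rfl⟩
    refine le_csSup_of_le ⟨1, ?_⟩ ⟨x, rfl, rfl⟩ hx
    rintro _ ⟨z, -, rfl⟩
    exact (hu z).2
end

section
/- Let u, v be m-cell fuzzy numbers and suppose v is strong positive (every y ∈ [v]_0 satisfies y_i > 0 for all i) or strong negative (every y ∈ [v]_0 satisfies y_i < 0 for all i). Then u/v is an m-cell fuzzy number and, for every θ ∈ [0,1], [u/v]_θ = { (x_1/y_1, …, x_m/y_m) : x ∈ [u]_θ, y ∈ [v]_θ }. -/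
open Set

theorem cut_of_ne_zero {X : Type*} [TopologicalSpace X] (u : X → ℝ) {α : ℝ} (h : α ≠ 0) :
    cut u α = {x | α ≤ u x} := if_neg h

theorem cut_zero {X : Type*} [TopologicalSpace X] (u : X → ℝ) :
    cut u 0 = closure {x | 0 < u x} := if_pos rfl

theorem cut_subset_cut_zero {X : Type*} [TopologicalSpace X] (u : X → ℝ) {α : ℝ} (h : 0 ≤ α) :
    cut u α ⊆ cut u 0 := by
  rcases h.eq_or_lt with rfl | h
  · rfl
  · rw [cut_of_ne_zero u h.ne', cut_zero]
    exact fun x hx => subset_closure (h.trans_le hx)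

namespace IsCellFuzzyNumber

variable {m : ℕ} {u : (Fin m → ℝ) → ℝ}

theorem isCompact_cut (hu : IsCellFuzzyNumber u) {α : ℝ} (hα : α ∈ Icc (0 : ℝ) 1) :
    IsCompact (cut u α) := by
  obtain ⟨a, b, -, h⟩ := hu.2 α hα
  rw [h]
  exact isCompact_univ_pi fun _ => isCompact_Icc

theorem cut_nonempty (hu : IsCellFuzzyNumber u) {α : ℝ} (hα : α ∈ Icc (0 : ℝ) 1) :
    (cut u α).Nonempty := by
  obtain ⟨a, b, hab, h⟩ := hu.2 α hα
  rw [h]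
  exact ⟨a, fun k _ => left_mem_Icc.2 (hab k)⟩

theorem upperSemicontinuous (hu : IsCellFuzzyNumber u) : UpperSemicontinuous u := by
  rw [upperSemicontinuous_iff_isClosed_preimage]
  intro α
  rcases le_or_gt α 0 with h0 | h0
  · convert isClosed_univ
    exact eq_univ_of_forall fun x => h0.trans (hu.1 x).1
  rcases le_or_gt α 1 with h1 | h1
  · have h := (hu.isCompact_cut ⟨h0.le, h1⟩).isClosed
    rwa [cut_of_ne_zero u h0.ne'] at h
  · convert isClosed_empty
    exact eq_empty_of_forall_notMem fun x hx => (h1.trans_le hx).not_ge (hu.1 x).2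

end IsCellFuzzyNumber

/-- The supremum defining `fdiv u v z` is attained at a point of the support of `v`. -/
theorem exists_fdiv_eq {m : ℕ} {u v : (Fin m → ℝ) → ℝ}
    (hu : IsCellFuzzyNumber u) (hv : IsCellFuzzyNumber v)
    (hv0 : ∀ y ∈ cut v 0, ∀ i, y i ≠ 0) (z : Fin m → ℝ) :
    ∃ y ∈ cut v 0, fdiv u v z = min (u (y * z)) (v y) := by
  have h0 : (0 : ℝ) ∈ Icc (0 : ℝ) 1 := ⟨le_rfl, zero_le_one⟩
  have husc : UpperSemicontinuous fun y => min (u (y * z)) (v y) :=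
    (hu.upperSemicontinuous.comp (continuous_id.mul continuous_const)).inf hv.upperSemicontinuous
  obtain ⟨y, hy, hmax⟩ := (husc.upperSemicontinuousOn _).exists_isMaxOn
    (hv.cut_nonempty h0) (hv.isCompact_cut h0)
  refine ⟨y, hy, IsGreatest.csSup_eq ⟨⟨y * z, y, fun i => ?_, rfl⟩, ?_⟩⟩
  · exact mul_div_cancel_left₀ _ (hv0 y hy i)
  · rintro t ⟨x, y', hz, rfl⟩
    rcases (hv.1 y').1.eq_or_lt with h | h
    · exact (min_le_right _ _).trans (h ▸ le_min (hu.1 _).1 (hv.1 _).1)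
    · have hy' : y' ∈ cut v 0 := by
        rw [cut_zero]
        exact subset_closure h
      have hx : x = y' * z := by
        ext i
        rw [Pi.mul_apply, ← hz i, mul_div_cancel₀ _ (hv0 y' hy' i)]
      rw [hx]
      exact hmax hy'

theorem min_le_fdiv {m : ℕ} {u v : (Fin m → ℝ) → ℝ} (hu : ∀ x, u x ≤ 1) (x y : Fin m → ℝ) :
    min (u x) (v y) ≤ fdiv u v (fun i => x i / y i) := by
  refine le_csSup ⟨1, ?_⟩ ⟨x, y, fun _ => rfl, rfl⟩
  rintro t ⟨x, y, -, rfl⟩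
  exact (min_le_left _ _).trans (hu x)

theorem cut_fdiv {m : ℕ} {u v : (Fin m → ℝ) → ℝ}
    (hu : IsCellFuzzyNumber u) (hv : IsCellFuzzyNumber v)
    (hv0 : ∀ y ∈ cut v 0, ∀ i, y i ≠ 0) {θ : ℝ} (hθ : 0 ≤ θ) :
    cut (fdiv u v) θ = {z | ∃ x ∈ cut u θ, ∃ y ∈ cut v θ, z = fun i => x i / y i} := by
  rcases hθ.eq_or_lt with rfl | h
  · have h0 : (0 : ℝ) ∈ Icc (0 : ℝ) 1 := ⟨le_rfl, zero_le_one⟩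
    let f : (Fin m → ℝ) × (Fin m → ℝ) → Fin m → ℝ := fun p i => p.1 i / p.2 i
    have hf : ContinuousOn f (cut u 0 ×ˢ cut v 0) := by
      refine continuousOn_pi.2 fun i => ContinuousOn.div (by fun_prop) (by fun_prop) ?_
      exact fun p hp => hv0 _ hp.2 i
    have himage : {z | ∃ x ∈ cut u 0, ∃ y ∈ cut v 0, z = fun i => x i / y i} =
        f '' (cut u 0 ×ˢ cut v 0) := by
      ext z
      constructor
      · rintro ⟨x, hx, y, hy, rfl⟩
        exact ⟨(x, y), ⟨hx, hy⟩, rfl⟩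
      · rintro ⟨p, hp, rfl⟩
        exact ⟨p.1, hp.1, p.2, hp.2, rfl⟩
    rw [himage, cut_zero]
    apply Subset.antisymm
    · refine closure_minimal ?_
        (((hu.isCompact_cut h0).prod (hv.isCompact_cut h0)).image_of_continuousOn hf).isClosed
      intro z hz
      obtain ⟨y, hy, heq⟩ := exists_fdiv_eq hu hv hv0 z
      rw [mem_ofPred_eq, heq, lt_min_iff] at hz
      refine ⟨(y * z, y), ⟨?_, hy⟩, ?_⟩
      · rw [cut_zero]
        exact subset_closure hz.1
      · ext i
        exact mul_div_cancel_left₀ _ (hv0 y hy i)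
    · rw [cut_zero, cut_zero, ← closure_prod_eq] at hf ⊢
      refine hf.image_closure.trans (closure_mono ?_)
      rintro _ ⟨p, hp, rfl⟩
      exact (lt_min hp.1 hp.2).trans_le (min_le_fdiv (fun x => (hu.1 x).2) p.1 p.2)
  · rw [cut_of_ne_zero _ h.ne', cut_of_ne_zero _ h.ne', cut_of_ne_zero _ h.ne']
    ext z
    constructor
    · intro hz
      obtain ⟨y, hy, heq⟩ := exists_fdiv_eq hu hv hv0 z
      rw [mem_ofPred_eq, heq, le_min_iff] at hz
      refine ⟨y * z, hz.1, y, hz.2, ?_⟩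
      ext i
      exact (mul_div_cancel_left₀ _ (hv0 y hy i)).symm
    · rintro ⟨x, hx, y, hy, rfl⟩
      exact (le_min hx hy).trans (min_le_fdiv (fun x => (hu.1 x).2) x y)

theorem exists_image2_div_eq_Icc {a b c d : ℝ} (hab : a ≤ b) (hcd : c ≤ d)
    (h0 : ∀ t ∈ Icc c d, t ≠ 0) :
    ∃ p q : ℝ, p ≤ q ∧ image2 (· / ·) (Icc a b) (Icc c d) = Icc p q := by
  have hf : ContinuousOn (fun p : ℝ × ℝ => p.1 / p.2) (Icc a b ×ˢ Icc c d) :=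
    ContinuousOn.div (by fun_prop) (by fun_prop) fun p hp => h0 _ hp.2
  have hne : (image2 (· / ·) (Icc a b) (Icc c d)).Nonempty :=
    (nonempty_Icc.2 hab).image2 (nonempty_Icc.2 hcd)
  have hconn : IsConnected (image2 (· / ·) (Icc a b) (Icc c d)) := by
    refine ⟨hne, ?_⟩
    rw [← image_prod]
    exact (isPreconnected_Icc.prod isPreconnected_Icc).image _ hf
  have hcomp : IsCompact (image2 (· / ·) (Icc a b) (Icc c d)) := by
    rw [← image_prod]
    exact (isCompact_Icc.prod isCompact_Icc).image_of_continuousOn hf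
  have h := eq_Icc_of_connected_compact hconn hcomp
  exact ⟨_, _, nonempty_Icc.1 (h ▸ hne), h⟩

theorem exists_pi_Icc_div_eq {m : ℕ} {a b c d : Fin m → ℝ} (hab : ∀ k, a k ≤ b k)
    (hcd : ∀ k, c k ≤ d k)
    (h0 : ∀ y ∈ univ.pi (fun k => Icc (c k) (d k)), ∀ i, y i ≠ 0) :
    ∃ p q : Fin m → ℝ, (∀ k, p k ≤ q k) ∧
      {z | ∃ x ∈ univ.pi (fun k => Icc (a k) (b k)), ∃ y ∈ univ.pi (fun k => Icc (c k) (d k)),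
        z = fun i => x i / y i} = univ.pi (fun k => Icc (p k) (q k)) := by
  have h0' : ∀ k, ∀ t ∈ Icc (c k) (d k), t ≠ 0 := by
    intro k t ht
    have h := h0 (Function.update c k t) ?_ k
    · simpa using h
    · intro j _
      rcases eq_or_ne j k with rfl | hj
      · simpa using ht
      · simpa [hj] using hcd j
  choose p q hpq h using fun k => exists_image2_div_eq_Icc (hab k) (hcd k) (h0' k)
  refine ⟨p, q, hpq, ?_⟩
  ext z
  constructor
  · rintro ⟨x, hx, y, hy, rfl⟩ k -
    change _ ∈ Icc (p k) (q k)
    rw [← h k]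
    exact mem_image2_of_mem (hx k trivial) (hy k trivial)
  · intro hz
    have hz' : ∀ k, ∃ s ∈ Icc (a k) (b k), ∃ t ∈ Icc (c k) (d k), s / t = z k := fun k => by
      have : z k ∈ Icc (p k) (q k) := hz k trivial
      rwa [← h k] at this
    choose x hx y hy hxy using hz'
    exact ⟨x, fun k _ => hx k, y, fun k _ => hy k, funext fun k => (hxy k).symm⟩

theorem stmt16 {m : ℕ} (u v : (Fin m → ℝ) → ℝ)
    (hu : IsCellFuzzyNumber u) (hv : IsCellFuzzyNumber v)
    (hvsign : (∀ y ∈ cut v 0, ∀ i, 0 < y i) ∨ (∀ y ∈ cut v 0, ∀ i, y i < 0)) :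
    IsCellFuzzyNumber (fdiv u v) ∧
      ∀ θ ∈ Icc (0 : ℝ) 1,
        cut (fdiv u v) θ =
          {z | ∃ x ∈ cut u θ, ∃ y ∈ cut v θ, z = fun i => x i / y i} := by
  have hv0 : ∀ y ∈ cut v 0, ∀ i, y i ≠ 0 := fun y hy i =>
    hvsign.elim (fun h => (h y hy i).ne') fun h => (h y hy i).ne
  refine ⟨⟨fun z => ?_, fun α hα => ?_⟩, fun θ hθ => cut_fdiv hu hv hv0 hθ.1⟩
  · obtain ⟨y, -, h⟩ := exists_fdiv_eq hu hv hv0 z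
    rw [h]
    exact ⟨le_min (hu.1 _).1 (hv.1 _).1, (min_le_left _ _).trans (hu.1 _).2⟩
  · obtain ⟨a, b, hab, hua⟩ := hu.2 α hα
    obtain ⟨c, d, hcd, hva⟩ := hv.2 α hα
    rw [cut_fdiv hu hv hv0 hα.1, hua, hva]
    refine exists_pi_Icc_div_eq hab hcd fun y hy => hv0 y (cut_subset_cut_zero v hα.1 ?_)
    rwa [hva]
end
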